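/- Let < be a well-founded strict partial order on a set X. Then the binary relation ⊑ on the powerset of X, defined by X₁ ⊑ X₂ iff for every x₂ ∈ X₂ \ X₁ there exists x₁ ∈ X₁ \ X₂ with x₁ < x₂, is a partial order (reflexive, antisymmetric, and transitive). -/

import Mathlib

/-- If `<` is a well-founded strict partial order on `X`
(antisymmetric, irreflexive, transitive, and every nonempty subset has a
`<`-minimal element), then the relation `⊑` on the powerset of `X` defined by
`X₁ ⊑ X₂` iff every `x₂ ∈ X₂ \ X₁` is countered by some `x₁ ∈ X₁ \ X₂` with
`x₁ < x₂` is a partial order: reflexive, antisymmetric and transitive. -/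
theorem sqsubseteq_is_partialOrder {X : Type} (lt : X → X → Prop)
    (hIrr : ∀ x, ¬ lt x x)
    (hTrans : ∀ x y z, lt x y → lt y z → lt x z)
    (hAntisymm : ∀ x y, lt x y → lt y x → x = y)
    (hWF : ∀ S : Set X, S.Nonempty → ∃ m ∈ S, ∀ x ∈ S, ¬ lt x m) :
    (∀ A : Set X, (∀ x₂ ∈ A \ A, ∃ x₁ ∈ A \ A, lt x₁ x₂)) ∧
    (∀ A B : Set X,
      (∀ x₂ ∈ B \ A, ∃ x₁ ∈ A \ B, lt x₁ x₂) →
      (∀ x₂ ∈ A \ B, ∃ x₁ ∈ B \ A, lt x₁ x₂) → A = B) ∧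
    (∀ A B C : Set X,
      (∀ x₂ ∈ B \ A, ∃ x₁ ∈ A \ B, lt x₁ x₂) →
      (∀ x₂ ∈ C \ B, ∃ x₁ ∈ B \ C, lt x₁ x₂) →
      (∀ x₂ ∈ C \ A, ∃ x₁ ∈ A \ C, lt x₁ x₂)) := by
  refine ⟨fun A x hx => absurd hx.1 hx.2, fun A B hAB hBA => ?_, fun A B C hAB hBC c hc => ?_⟩
  · by_contra hne
    have hS : ((A \ B) ∪ (B \ A)).Nonempty := by
      rw [Set.nonempty_iff_ne_empty]
      intro h
      rw [Set.union_empty_iff, Set.sdiff_eq_empty, Set.sdiff_eq_empty] at h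
      exact hne (h.1.antisymm h.2)
    obtain ⟨m, hm | hm, hmin⟩ := hWF _ hS
    · obtain ⟨x, hx, hlt⟩ := hBA m hm
      exact hmin x (Or.inr hx) hlt
    · obtain ⟨x, hx, hlt⟩ := hAB m hm
      exact hmin x (Or.inl hx) hlt
  · have hS : {x | (x ∈ A \ B ∨ x ∈ B \ C) ∧ lt x c}.Nonempty := by
      by_cases hcB : c ∈ B
      · obtain ⟨a, ha, hlt⟩ := hAB c ⟨hcB, hc.2⟩
        exact ⟨a, Or.inl ha, hlt⟩
      · obtain ⟨b, hb, hlt⟩ := hBC c ⟨hc.1, hcB⟩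
        exact ⟨b, Or.inr hb, hlt⟩
    obtain ⟨m, ⟨hm | hm, hmc⟩, hmin⟩ := hWF _ hS
    · refine ⟨m, ⟨hm.1, fun hmC => ?_⟩, hmc⟩
      obtain ⟨b, hb, hlt⟩ := hBC m ⟨hmC, hm.2⟩
      exact hmin b ⟨Or.inr hb, hTrans _ _ _ hlt hmc⟩ hlt
    · refine ⟨m, ⟨by_contra fun hmA => ?_, hm.2⟩, hmc⟩
      obtain ⟨a, ha, hlt⟩ := hAB m ⟨hm.1, hmA⟩
      exact hmin a ⟨Or.inl ha, hTrans _ _ _ hlt hmc⟩ hlt
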